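/- arXiv:2008.00200 — 3 statements merged into one kernel-verified Lean document; each statement's English description precedes it below -/
import Mathlib

section
/- Let q be a prime with q > 7 and F = F_q, let x ∈ F satisfy x ∉ {0, 1, −1, 2, −2, 1/2} and x⁶ ≠ 1, and set T = P_0 ∪ P_1 ∪ P_x ∪ C_1 ∪ C_{−1}. Then the automorphism group of the Cayley graph Cay(H,T) equals the permutation group Ḡ on H generated by the right regular action of H on itself and the conjugation action of D on H; in particular, Aut(Cay(H,T)) has order 4q³. -/
open Matrix Pointwise

abbrev SL3 (F : Type*) [Field F] := Matrix.SpecialLinearGroup (Fin 3) F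

variable (F : Type*) [Field F]

/-- The subgroup `G` of `SL₃(F)`, as a set of matrices. -/
def GSet : Set (SL3 F) :=
  {g | ∃ a b c x y z : F, (a = 1 ∨ a = -1) ∧ (b = 1 ∨ b = -1) ∧ (c = 1 ∨ c = -1) ∧
    a * b * c = 1 ∧ (g : Matrix (Fin 3) (Fin 3) F) = !![a, x, z; 0, b, y; 0, 0, c]}

/-- The subgroup `D` of `SL₃(F)`, as a set of matrices. -/
def DSet : Set (SL3 F) :=
  {g | ∃ a x : F, (a = 1 ∨ a = -1) ∧
    (g : Matrix (Fin 3) (Fin 3) F) = !![a, a * x, a * x ^ 2 / 2; 0, 1, x; 0, 0, a]}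

/-- The matrix `h(a,x,y)`. -/
def hMat (a x y : F) : Matrix (Fin 3) (Fin 3) F := !![a, 0, x; 0, a, y; 0, 0, 1]

/-- The subgroup `H` of `SL₃(F)`, as a set of matrices. -/
def HSet : Set (SL3 F) :=
  {g | ∃ a x y : F, (a = 1 ∨ a = -1) ∧ (g : Matrix (Fin 3) (Fin 3) F) = hMat F a x y}

/-- The subgroup `K` of `SL₃(F)`, as a set of matrices. -/
def KSet : Set (SL3 F) :=
  {g | ∃ a x y : F, (a = 1 ∨ a = -1) ∧
    (g : Matrix (Fin 3) (Fin 3) F) = !![1, x, y; 0, a, 0; 0, 0, a]}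

/-- The singleton set `S_t = {h(1,t,0)}`. -/
def Sorb (t : F) : Set (SL3 F) := {g | (g : Matrix (Fin 3) (Fin 3) F) = hMat F 1 t 0}

/-- The set `C_t = {h(1,z,t) : z ∈ F}`. -/
def Corb (t : F) : Set (SL3 F) := {g | ∃ z : F, (g : Matrix (Fin 3) (Fin 3) F) = hMat F 1 z t}

/-- The parabolic set `P_t = {h(-1,t+z²,2z) : z ∈ F}`. -/
def Porb (t : F) : Set (SL3 F) :=
  {g | ∃ z : F, (g : Matrix (Fin 3) (Fin 3) F) = hMat F (-1) (t + z ^ 2) (2 * z)}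

/-- The orbit of `h` under the conjugation action of `D`. -/
def DOrbit (h : SL3 F) : Set (SL3 F) := {h' | ∃ d ∈ DSet F, h' = d⁻¹ * h * d}

/-- The permutations of `H` given by right multiplication by an element of `H`. -/
def RightMulPerms : Set (Equiv.Perm ↥(HSet F)) :=
  {σ | ∃ h ∈ HSet F, ∀ x : ↥(HSet F), (↑(σ x) : SL3 F) = ↑x * h}

/-- The permutations of `H` given by conjugation by an element of `D`. -/
def ConjPerms : Set (Equiv.Perm ↥(HSet F)) :=
  {σ | ∃ d ∈ DSet F, ∀ x : ↥(HSet F), (↑(σ x) : SL3 F) = d⁻¹ * ↑x * d}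

/-- The permutation group `Ḡ ≤ Sym(H)` generated by the right regular action of `H`
together with the conjugation action of `D` on `H`. -/
def GBar : Subgroup (Equiv.Perm ↥(HSet F)) :=
  Subgroup.closure (RightMulPerms F ∪ ConjPerms F)

/-- The automorphisms of the Cayley graph `Cay(H,T)`, as permutations of `H`. -/
def CayAut (T : Set (SL3 F)) : Set (Equiv.Perm ↥(HSet F)) :=
  {σ | ∀ u v : ↥(HSet F),
    ((u : SL3 F) * (v : SL3 F)⁻¹ ∈ T) ↔ ((σ u : SL3 F) * ((σ v : SL3 F))⁻¹ ∈ T)}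

section Model

/-- The vertices of the model: a coset of the translation subgroup, a parabolic coordinate `X`,
and a level `y`. -/
abbrev Vert (F : Type*) := Bool × F × F

/-- The model of `Cay(H,T)`: vertices of the same coset are joined when their levels differ by
`±1`, vertices of different cosets when a bilinear expression lies in `S`. -/
def modelAdj {F : Type*} [Field F] (S : Set F) (u v : Vert F) : Prop :=
  if u.1 = v.1 then u.2.2 - v.2.2 = 1 ∨ u.2.2 - v.2.2 = -1
  else u.2.1 + v.2.1 - u.2.2 * v.2.2 / 2 ∈ S

/-- The common neighbours of two vertices. -/
def commonNbrs {F : Type*} [Field F] (S : Set F) (u v : Vert F) : Set (Vert F) :=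
  {w | modelAdj S u w ∧ modelAdj S v w}

/-- The sign attached to a coset. -/
def boolSign {F : Type*} [Field F] (b : Bool) : F := if b then -1 else 1

/-- The standard automorphisms of the model. -/
def modelMap {F : Type*} [Field F] (p : Bool × Bool × F × F × F) (u : Vert F) : Vert F :=
  match p, u with
  | (r, a, t₀, t₁, c), (false, X, y) =>
    (r, X + t₁ * boolSign a * y / 2 + c, boolSign a * y + t₀)
  | (r, a, t₀, t₁, c), (true, X, y) =>
    (!r, X + t₀ * boolSign a * y / 2 + t₀ * t₁ / 2 - c, boolSign a * y + t₁)

variable {F : Type*} [Field F] {S : Set F}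

lemma boolSign_false : (boolSign false : F) = 1 := rfl

lemma boolSign_true : (boolSign true : F) = -1 := rfl

lemma modelMap_false (r a : Bool) (t₀ t₁ c X y : F) :
    modelMap (r, a, t₀, t₁, c) (false, X, y) =
      (r, X + t₁ * boolSign a * y / 2 + c, boolSign a * y + t₀) := rfl

lemma modelMap_true (r a : Bool) (t₀ t₁ c X y : F) :
    modelMap (r, a, t₀, t₁, c) (true, X, y) =
      (!r, X + t₀ * boolSign a * y / 2 + t₀ * t₁ / 2 - c, boolSign a * y + t₁) := rfl

lemma boolSign_mul_self (b : Bool) : (boolSign b : F) * boolSign b = 1 := by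
  cases b <;> simp [boolSign]

lemma boolSign_ne_zero (b : Bool) : (boolSign b : F) ≠ 0 := by
  cases b <;> simp [boolSign]

lemma boolSign_xor (b c : Bool) : (boolSign (xor b c) : F) = boolSign b * boolSign c := by
  cases b <;> cases c <;> simp [boolSign]

lemma four_ne_zero_of_two_ne_zero (h2 : (2 : F) ≠ 0) : (4 : F) ≠ 0 := by
  rw [show (4 : F) = 2 * 2 by norm_num]
  exact mul_ne_zero h2 h2

lemma boolSign_injective (h2 : (2 : F) ≠ 0) : Function.Injective (boolSign : Bool → F) := by
  have : (1 : F) ≠ -1 := fun h => h2 (by linear_combination h)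
  intro a b h
  cases a <;> cases b <;> simp_all [boolSign]

lemma exists_boolSign {a : F} (ha : a = 1 ∨ a = -1) : ∃ b : Bool, a = boolSign b := by
  rcases ha with rfl | rfl
  exacts [⟨false, by simp [boolSign]⟩, ⟨true, by simp [boolSign]⟩]

lemma boolSign_eq (b : Bool) : (boolSign b : F) = 1 ∨ (boolSign b : F) = -1 := by
  cases b <;> simp [boolSign]

lemma modelAdj_of_eq {u v : Vert F} (h : u.1 = v.1) :
    modelAdj S u v ↔ (u.2.2 - v.2.2 = 1 ∨ u.2.2 - v.2.2 = -1) := by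
  simp [modelAdj, h]

lemma modelAdj_of_ne {u v : Vert F} (h : u.1 ≠ v.1) :
    modelAdj S u v ↔ u.2.1 + v.2.1 - u.2.2 * v.2.2 / 2 ∈ S := by
  simp [modelAdj, h]

lemma modelMap_injective (p : Bool × Bool × F × F × F) : Function.Injective (modelMap p) := by
  obtain ⟨r, a, t₀, t₁, c⟩ := p
  have ha := boolSign_ne_zero (F := F) a
  rintro ⟨b, X, y⟩ ⟨b', X', y'⟩ h
  cases b <;> cases b' <;> simp only [modelMap, Prod.mk.injEq] at h
  · obtain ⟨-, h1, h2⟩ := h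
    have : y = y' := mul_left_cancel₀ ha (by linear_combination h2)
    subst this
    simpa using h1
  · simp at h
  · simp at h
  · obtain ⟨-, h1, h2⟩ := h
    have : y = y' := mul_left_cancel₀ ha (by linear_combination h2)
    subst this
    simpa using h1

/-- The map `modelMap p` as a permutation. -/
noncomputable def modelPerm [Finite F] (p : Bool × Bool × F × F × F) : Equiv.Perm (Vert F) :=
  Equiv.ofBijective (modelMap p) (Finite.injective_iff_bijective.1 (modelMap_injective p))

lemma modelPerm_apply [Finite F] (p : Bool × Bool × F × F × F) (u : Vert F) :
    modelPerm p u = modelMap p u := rfl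

lemma modelPerm_injective [Finite F] (h2 : (2 : F) ≠ 0) :
    Function.Injective (modelPerm : Bool × Bool × F × F × F → Equiv.Perm (Vert F)) := by
  rintro ⟨r, a, t₀, t₁, c⟩ ⟨r', a', t₀', t₁', c'⟩ h
  have e1 := DFunLike.congr_fun h (false, 0, 0)
  have e2 := DFunLike.congr_fun h (true, 0, 0)
  have e3 := DFunLike.congr_fun h (false, 0, 1)
  simp only [modelPerm_apply, modelMap, Prod.mk.injEq, mul_zero, zero_div, zero_add, mul_one]
    at e1 e2 e3
  obtain ⟨rfl, rfl, rfl⟩ := e1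
  obtain ⟨-, -, rfl⟩ := e2
  have := boolSign_injective h2 (add_right_cancel e3.2.2)
  simp [this]

lemma modelAdj_modelMap (p : Bool × Bool × F × F × F) (h2 : (2 : F) ≠ 0) (u v : Vert F) :
    modelAdj S u v ↔ modelAdj S (modelMap p u) (modelMap p v) := by
  obtain ⟨r, a, t₀, t₁, c⟩ := p
  have key : ∀ d : F, (d = 1 ∨ d = -1) ↔ (boolSign a * d = 1 ∨ boolSign a * d = -1) := by
    intro d
    rcases boolSign_eq (F := F) a with h | h <;> rw [h]
    · simp
    · simp only [neg_mul, one_mul, neg_eq_iff_eq_neg, neg_neg]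
      tauto
  have ha := boolSign_mul_self (F := F) a
  obtain ⟨b, X, y⟩ := u
  obtain ⟨b', X', y'⟩ := v
  cases b <;> cases b' <;> simp only [modelAdj, modelMap]
  · simp only [if_true]
    rw [key, show boolSign a * (y - y') = boolSign a * y + t₀ - (boolSign a * y' + t₀) by ring]
  · simp only [Bool.false_eq_true, if_false, Bool.eq_not_self]
    rw [show X + X' - y * y' / 2 = X + t₁ * boolSign a * y / 2 + c +
        (X' + t₀ * boolSign a * y' / 2 + t₀ * t₁ / 2 - c) -
        (boolSign a * y + t₀) * (boolSign a * y' + t₁) / 2 by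
      field_simp
      linear_combination (y * y') * ha]
  · simp only [Bool.true_eq_false, if_false, Bool.not_eq_self]
    rw [show X + X' - y * y' / 2 = X + t₀ * boolSign a * y / 2 + t₀ * t₁ / 2 - c +
        (X' + t₁ * boolSign a * y' / 2 + c) -
        (boolSign a * y + t₁) * (boolSign a * y' + t₀) / 2 by
      field_simp
      linear_combination (y * y') * ha]
  · simp only [if_true]
    rw [key, show boolSign a * (y - y') = boolSign a * y + t₁ - (boolSign a * y' + t₁) by ring]

lemma ncard_commonNbrs_le [Finite F] (h2 : (2 : F) ≠ 0) (h3 : (3 : F) ≠ 0) (hS : S.ncard = 3)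
    {u v : Vert F} (huv : modelAdj S u v) (h : u.1 = v.1) : (commonNbrs S u v).ncard ≤ 9 := by
  rw [modelAdj_of_eq h] at huv
  have hne : ∀ w ∈ commonNbrs S u v, u.1 ≠ w.1 := by
    rintro w ⟨hu, hv⟩ huw
    rw [modelAdj_of_eq huw] at hu
    rw [modelAdj_of_eq (h ▸ huw)] at hv
    rcases huv with e | e <;> rcases hu with f | f <;> rcases hv with g | g
    · exact one_ne_zero (by linear_combination f - g - e)
    · exact one_ne_zero (by linear_combination e - f + g)
    · exact h3 (by linear_combination f - g - e)
    · exact one_ne_zero (by linear_combination f - g - e)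
    · exact one_ne_zero (by linear_combination e - f + g)
    · exact h3 (by linear_combination e - f + g)
    · exact one_ne_zero (by linear_combination f - g - e)
    · exact one_ne_zero (by linear_combination e - f + g)
  have hprod : (S ×ˢ S).ncard = 9 := by rw [Set.ncard_prod, hS]
  rw [← hprod]
  refine Set.ncard_le_ncard_of_injOn
    (fun w => (u.2.1 + w.2.1 - u.2.2 * w.2.2 / 2, v.2.1 + w.2.1 - v.2.2 * w.2.2 / 2)) ?_ ?_
    (Set.toFinite _)
  · intro w hw
    have := hne w hw
    exact ⟨(modelAdj_of_ne this).1 hw.1, (modelAdj_of_ne (h ▸ this)).1 hw.2⟩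
  · intro w hw w' hw' e
    have hb : w.1 = w'.1 := by
      have := hne w hw
      have := hne w' hw'
      revert this
      cases h1 : u.1 <;> cases h2 : w.1 <;> cases h3 : w'.1 <;> simp_all
    simp only [Prod.mk.injEq] at e
    obtain ⟨e1, e2⟩ := e
    have hy : w.2.2 = w'.2.2 := by
      have : (u.2.2 - v.2.2) * (w.2.2 - w'.2.2) = 0 := by
        field_simp at e1 e2
        linear_combination e2 - e1
      rcases mul_eq_zero.1 this with h0 | h0
      · rw [h0] at huv
        simp at huv
      · exact sub_eq_zero.1 h0
    refine Prod.ext hb (Prod.ext ?_ hy)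
    rw [hy] at e1
    linear_combination e1

lemma lt_ncard_commonNbrs [Finite F] (h2 : (2 : F) ≠ 0) (hS : S.ncard = 3)
    {u v : Vert F} (h : u.1 ≠ v.1) : 9 < (commonNbrs S u v).ncard := by
  have hprod : ((Set.univ : Set (Bool × Bool)) ×ˢ S).ncard = 12 := by
    rw [Set.ncard_prod, hS, Set.ncard_univ]
    simp
  suffices 12 ≤ (commonNbrs S u v).ncard by omega
  rw [← hprod]
  refine Set.ncard_le_ncard_of_injOn (fun k : (Bool × Bool) × F =>
    if k.1.1 then ((u.1, k.2 - v.2.1 + v.2.2 * (u.2.2 + boolSign k.1.2) / 2,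
      u.2.2 + boolSign k.1.2) : Vert F)
    else (v.1, k.2 - u.2.1 + u.2.2 * (v.2.2 + boolSign k.1.2) / 2,
      v.2.2 + boolSign k.1.2)) ?_ ?_ (Set.toFinite _)
  · have hcancel : ∀ A B s : F, A + (s - A + B) - B = s := fun A B s => by ring
    rintro ⟨⟨i, j⟩, s⟩ ⟨-, hs⟩
    have hj : (boolSign j : F) = 1 ∨ (boolSign j : F) = -1 := boolSign_eq j
    have hj' : -(boolSign j : F) = 1 ∨ -(boolSign j : F) = -1 := by
      rcases hj with e | e <;> simp [e]
    cases i
    · refine ⟨(modelAdj_of_ne (by simpa using h)).2 ?_, (modelAdj_of_eq (by simp)).2 ?_⟩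
      · simpa [hcancel] using hs
      · simpa using hj'
    · refine ⟨(modelAdj_of_eq (by simp)).2 ?_, (modelAdj_of_ne (by simpa using h.symm)).2 ?_⟩
      · simpa using hj'
      · simpa [hcancel] using hs
  · rintro ⟨⟨i, j⟩, s⟩ - ⟨⟨i', j'⟩, s'⟩ - e
    cases i <;> cases i' <;> simp only [Bool.false_eq_true, if_false, if_true, Prod.mk.injEq] at e
    · obtain ⟨-, e1, e2⟩ := e
      obtain rfl := boolSign_injective h2 (add_left_cancel e2)
      simpa using e1
    · exact absurd e.1.symm h
    · exact absurd e.1 h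
    · obtain ⟨-, e1, e2⟩ := e
      obtain rfl := boolSign_injective h2 (add_left_cancel e2)
      simpa using e1

/-- Edges inside a coset are those with at most nine common neighbours. -/
lemma fst_eq_iff_ncard_commonNbrs_le [Finite F] (h2 : (2 : F) ≠ 0) (h3 : (3 : F) ≠ 0)
    (hS : S.ncard = 3) {u v : Vert F} (huv : modelAdj S u v) :
    u.1 = v.1 ↔ (commonNbrs S u v).ncard ≤ 9 :=
  ⟨ncard_commonNbrs_le h2 h3 hS huv,
    fun h => by_contra fun hne => (lt_ncard_commonNbrs h2 hS hne).not_ge h⟩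

lemma fst_eq_iff_of_aut [Finite F] (h2 : (2 : F) ≠ 0) (h3 : (3 : F) ≠ 0) (hS : S.ncard = 3)
    {σ : Equiv.Perm (Vert F)} (hσ : ∀ u v, modelAdj S u v ↔ modelAdj S (σ u) (σ v))
    {u v : Vert F} (huv : modelAdj S u v) : u.1 = v.1 ↔ (σ u).1 = (σ v).1 := by
  have himage : commonNbrs S (σ u) (σ v) = σ '' commonNbrs S u v := by
    ext w
    obtain ⟨w, rfl⟩ := σ.surjective w
    simp [commonNbrs, ← hσ]
  rw [fst_eq_iff_ncard_commonNbrs_le h2 h3 hS huv,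
    fst_eq_iff_ncard_commonNbrs_le h2 h3 hS ((hσ u v).1 huv), himage,
    Set.ncard_image_of_injective _ σ.injective]

/-- Automorphisms map levels to levels. -/
lemma level_of_aut [Finite F] (h2 : (2 : F) ≠ 0) (h3 : (3 : F) ≠ 0) (hS : S.ncard = 3)
    {σ : Equiv.Perm (Vert F)} (hσ : ∀ u v, modelAdj S u v ↔ modelAdj S (σ u) (σ v))
    {u v : Vert F} (hfst : u.1 = v.1) (hy : u.2.2 = v.2.2) :
    (σ u).1 = (σ v).1 ∧ (σ u).2.2 = (σ v).2.2 := by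
  have key : ∀ w, (σ u).1 = w.1 → modelAdj S (σ u) w → (σ v).1 = w.1 ∧ modelAdj S (σ v) w := by
    intro w h1 h
    obtain ⟨w, rfl⟩ := σ.surjective w
    rw [← hσ] at h
    have huw := (fst_eq_iff_of_aut h2 h3 hS hσ h).2 h1
    have hvw : modelAdj S v w := by
      rw [modelAdj_of_eq huw] at h
      rw [modelAdj_of_eq (hfst ▸ huw), ← hy]
      exact h
    exact ⟨(fst_eq_iff_of_aut h2 h3 hS hσ hvw).1 (hfst ▸ huw), (hσ _ _).1 hvw⟩
  obtain ⟨e1, a1⟩ := key ((σ u).1, 0, (σ u).2.2 + 1) rfl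
    ((modelAdj_of_eq (by rfl)).2 (Or.inr (by simp)))
  obtain ⟨e2, a2⟩ := key ((σ u).1, 0, (σ u).2.2 - 1) rfl
    ((modelAdj_of_eq (by rfl)).2 (Or.inl (by simp)))
  rw [modelAdj_of_eq e1] at a1
  rw [modelAdj_of_eq e2] at a2
  refine ⟨e1.symm, ?_⟩
  dsimp only at a1 a2
  rcases a1 with a1 | a1
  · rcases a2 with a2 | a2
    · exact absurd (show (2 : F) = 0 by linear_combination a2 - a1) h2
    · have : (2 : F) * 2 = 0 := by linear_combination a2 - a1
      simp [h2] at this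
  · linear_combination -a1

lemma affine_of_step [Fintype F] (hq : (Fintype.card F).Prime) (h2 : (2 : F) ≠ 0) {π : F → F}
    (hinj : Function.Injective π) (hstep : ∀ y, π (y + 1) - π y = 1 ∨ π (y + 1) - π y = -1) :
    ∃ a : Bool, ∀ y, π y = boolSign a * y + π 0 := by
  obtain ⟨a, ha⟩ := exists_boolSign (hstep 0)
  rw [zero_add] at ha
  have hconst : ∀ n : ℕ, π (n + 1) - π n = boolSign a := by
    intro n
    induction n with
    | zero => simpa using ha
    | succ n ih =>
      have hne : π (n + 1 + 1) ≠ π n := fun h =>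
        h2 (by linear_combination hinj h)
      have := hstep (n + 1)
      push_cast
      rcases boolSign_eq (F := F) a with e | e <;> rw [e] at ih ⊢ <;> rcases this with h | h
      · exact h
      · exact absurd (by linear_combination h + ih) hne
      · exact absurd (by linear_combination h + ih) hne
      · exact h
  have hnat : ∀ n : ℕ, π n = boolSign a * n + π 0 := by
    intro n
    induction n with
    | zero => simp
    | succ n ih =>
      push_cast
      linear_combination hconst n + ih
  refine ⟨a, fun y => ?_⟩
  have := Fact.mk hq
  have : CharP F (Fintype.card F) := charP_of_card_eq_prime rfl
  obtain ⟨z, rfl⟩ := (ZMod.castHom_bijective F rfl).2 y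
  obtain ⟨n, rfl⟩ := ZMod.natCast_zmod_surjective z
  rw [map_natCast]
  exact hnat n

/-- The action of an automorphism on cosets and levels. -/
lemma exists_affine_of_aut [Fintype F] (hq : (Fintype.card F).Prime) (h2 : (2 : F) ≠ 0)
    (h3 : (3 : F) ≠ 0) (hS : S.ncard = 3) {σ : Equiv.Perm (Vert F)}
    (hσ : ∀ u v, modelAdj S u v ↔ modelAdj S (σ u) (σ v)) (b : Bool) :
    ∃ (r a : Bool) (t : F), ∀ X y, (σ (b, X, y)).1 = r ∧ (σ (b, X, y)).2.2 = boolSign a * y + t := by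
  have hσ' : ∀ u v, modelAdj S u v ↔ modelAdj S (σ.symm u) (σ.symm v) := fun u v => by
    rw [hσ (σ.symm u), Equiv.apply_symm_apply, Equiv.apply_symm_apply]
  have hadj : ∀ y, modelAdj S ((b, 0, y + 1) : Vert F) (b, 0, y) := fun y =>
    (modelAdj_of_eq (by rfl)).2 (Or.inl (by simp))
  have hfst : ∀ y, (σ (b, 0, y + 1)).1 = (σ (b, 0, y)).1 := fun y =>
    (fst_eq_iff_of_aut h2 h3 hS hσ (hadj y)).1 rfl
  have hstep : ∀ y, (σ (b, 0, y + 1)).2.2 - (σ (b, 0, y)).2.2 = 1 ∨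
      (σ (b, 0, y + 1)).2.2 - (σ (b, 0, y)).2.2 = -1 := fun y =>
    (modelAdj_of_eq (hfst y)).1 ((hσ _ _).1 (hadj y))
  have hfst' : ∀ y, (σ (b, 0, y)).1 = (σ (b, 0, 0)).1 := by
    intro y
    have := Fact.mk hq
    have : CharP F (Fintype.card F) := charP_of_card_eq_prime rfl
    obtain ⟨z, rfl⟩ := (ZMod.castHom_bijective F rfl).2 y
    obtain ⟨n, rfl⟩ := ZMod.natCast_zmod_surjective z
    rw [map_natCast]
    induction n with
    | zero => simp
    | succ n ih => rw [Nat.cast_succ, hfst, ih]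
  have hinj : Function.Injective fun y => (σ (b, 0, y)).2.2 := by
    intro y y' h
    have := level_of_aut h2 h3 hS hσ' (u := σ (b, 0, y)) (v := σ (b, 0, y'))
      ((hfst' y).trans (hfst' y').symm) h
    simpa using this.2
  obtain ⟨a, ha⟩ := affine_of_step hq h2 hinj hstep
  refine ⟨(σ (b, 0, 0)).1, a, (σ (b, 0, 0)).2.2, fun X y => ?_⟩
  obtain ⟨e1, e2⟩ := level_of_aut h2 h3 hS hσ (u := (b, X, y)) (v := (b, 0, y)) rfl rfl
  exact ⟨e1.trans (hfst' y), e2.trans (ha y)⟩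

lemma fiber_injective (hshift : ∀ c, (∀ k, k ∈ S ↔ k + c ∈ S) → c = 0) {f g : F → F}
    (h : ∀ X X', X + X' ∈ S ↔ f X + g X' ∈ S) : Function.Injective f := by
  intro X₁ X₂ e
  refine (sub_eq_zero.1 (hshift (X₂ - X₁) fun k => ?_)).symm
  have h1 := h X₁ (k - X₁)
  have h2 := h X₂ (k - X₁)
  rw [e, ← h2] at h1
  rwa [add_sub_cancel, add_sub_left_comm] at h1

lemma fiber_unique [Finite F] (hshift : ∀ c, (∀ k, k ∈ S ↔ k + c ∈ S) → c = 0)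
    {f g g' : F → F} (h : ∀ X X', X + X' ∈ S ↔ f X + g X' ∈ S)
    (h' : ∀ X X', X + X' ∈ S ↔ f X + g' X' ∈ S) : g = g' := by
  funext X'
  refine (sub_eq_zero.1 (hshift (g' X' - g X') fun k => ?_)).symm
  obtain ⟨X, hX⟩ := Finite.injective_iff_surjective.1 (fiber_injective hshift h) (k - g X')
  have := (h X X').symm.trans (h' X X')
  rw [hX] at this
  rwa [sub_add_cancel, sub_add_eq_add_sub, add_sub_assoc] at this

/-- The maps induced on the levels are translations, and the signs on the two cosets agree. -/
lemma fibers_translation [Finite F] (h2 : (2 : F) ≠ 0)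
    (hshift : ∀ c, (∀ k, k ∈ S ↔ k + c ∈ S) → c = 0)
    (hrefl : ∀ c, ¬ ∀ k, k ∈ S ↔ c - k ∈ S) {f g : F → F → F} {e : F} (he : e = 1 ∨ e = -1)
    (h : ∀ y X y' X', X + X' - y * y' / 2 ∈ S ↔ f y X + g y' X' - e * (y * y') / 2 ∈ S) :
    e = 1 ∧ ∃ c, ∀ y X, f y X = X + c ∧ g y X = X - c := by
  have hg : ∀ y', g y' = g 0 := fun y' => fiber_unique hshift (f := f 0)
    (fun X X' => by simpa using h 0 X y' X') (fun X X' => by simpa using h 0 X 0 X')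
  have hf : ∀ y, f y = f 0 := fun y => fiber_unique hshift (f := g 0)
    (fun X X' => by simpa [add_comm] using h y X' 0 X)
    (fun X X' => by simpa [add_comm] using h 0 X' 0 X)
  have hk : ∀ X X' k, X + X' - k ∈ S ↔ f 0 X + g 0 X' - e * k ∈ S := by
    intro X X' k
    have := h 2 X k X'
    rw [hf 2, hg k] at this
    rwa [mul_div_cancel_left₀ _ h2, mul_left_comm, mul_div_cancel_left₀ _ h2] at this
  have he1 : e = 1 := by
    refine he.resolve_right fun he' => hrefl (f 0 0 + g 0 0) fun k => ?_
    have := hk 0 0 (-k)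
    rw [he'] at this
    simpa using this
  refine ⟨he1, f 0 0, fun y X => ?_⟩
  have hsum : ∀ X X', f 0 X + g 0 X' = X + X' := by
    intro X X'
    refine sub_eq_zero.1 (hshift _ fun k => ?_)
    have := hk X X' (X + X' - k)
    rw [he1] at this
    convert this using 2 <;> ring
  rw [hf, hg]
  have h00 := hsum 0 0
  exact ⟨by linear_combination hsum X 0 - h00, by linear_combination hsum 0 X⟩

/-- Every automorphism of the model is a standard one. -/
lemma exists_eq_modelPerm [Fintype F] (hq : (Fintype.card F).Prime) (h2 : (2 : F) ≠ 0)
    (h3 : (3 : F) ≠ 0) (hS : S.ncard = 3) (h0 : (0 : F) ∈ S)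
    (hshift : ∀ c, (∀ k, k ∈ S ↔ k + c ∈ S) → c = 0)
    (hrefl : ∀ c, ¬ ∀ k, k ∈ S ↔ c - k ∈ S) {σ : Equiv.Perm (Vert F)}
    (hσ : ∀ u v, modelAdj S u v ↔ modelAdj S (σ u) (σ v)) : ∃ p, modelPerm p = σ := by
  obtain ⟨r, a, t₀, hf⟩ := exists_affine_of_aut hq h2 h3 hS hσ false
  obtain ⟨r', a', t₁, ht⟩ := exists_affine_of_aut hq h2 h3 hS hσ true
  have hr : r ≠ r' := by
    have hadj : modelAdj S ((false, 0, 0) : Vert F) (true, 0, 0) :=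
      (modelAdj_of_ne (by simp)).2 (by simpa using h0)
    have := fst_eq_iff_of_aut h2 h3 hS hσ hadj
    rw [(hf 0 0).1, (ht 0 0).1] at this
    simpa using this
  have hr' : r' = !r := by revert hr; cases r <;> cases r' <;> simp
  have hsign : (boolSign a * boolSign a' : F) = 1 ∨ (boolSign a * boolSign a' : F) = -1 := by
    rw [← boolSign_xor]
    exact boolSign_eq _
  obtain ⟨he, c, hc⟩ := fibers_translation h2 hshift hrefl hsign
    (f := fun y X => (σ (false, X, y)).2.1 - t₁ * boolSign a * y / 2)
    (g := fun y X => (σ (true, X, y)).2.1 - t₀ * boolSign a' * y / 2 - t₀ * t₁ / 2) (by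
      intro y X y' X'
      have := hσ (false, X, y) (true, X', y')
      rw [modelAdj_of_ne (by simp), modelAdj_of_ne (by rwa [(hf X y).1, (ht X' y').1]),
        (hf X y).2, (ht X' y').2] at this
      refine this.trans ?_
      rw [show ∀ A B : F, A + B - (boolSign a * y + t₀) * (boolSign a' * y' + t₁) / 2 =
        A - t₁ * boolSign a * y / 2 + (B - t₀ * boolSign a' * y' / 2 - t₀ * t₁ / 2) -
        boolSign a * boolSign a' * (y * y') / 2 from fun A B => by ring])
  have haa : a' = a := boolSign_injective h2 (mul_left_cancel₀ (boolSign_ne_zero a)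
    (he.trans (boolSign_mul_self a).symm))
  subst haa hr'
  refine ⟨(r, a', t₀, t₁, c), Equiv.ext ?_⟩
  rintro ⟨b, X, y⟩
  obtain ⟨c1, c2⟩ := hc y X
  cases b
  · refine Prod.ext (hf X y).1.symm (Prod.ext ?_ (hf X y).2.symm)
    simp only [modelPerm_apply, modelMap]
    linear_combination -c1
  · refine Prod.ext (ht X y).1.symm (Prod.ext ?_ (ht X y).2.symm)
    simp only [modelPerm_apply, modelMap]
    linear_combination -c2

end Model

section Coordinates

variable {F : Type*} [Field F]

/-- The element `h(±1,x,y)` of `SL₃(F)`. -/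
def hElt (b : Bool) (x y : F) : SL3 F :=
  ⟨hMat F (boolSign b) x y, by
    simp [hMat, Matrix.det_fin_three, boolSign_mul_self]⟩

/-- The element of `D` with parameters `±1` and `s`. -/
def dElt (b : Bool) (s : F) : SL3 F :=
  ⟨!![boolSign b, boolSign b * s, boolSign b * s ^ 2 / 2; 0, 1, s; 0, 0, boolSign b], by
    simp [Matrix.det_fin_three, boolSign_mul_self]⟩

lemma hElt_mem (b : Bool) (x y : F) : hElt b x y ∈ HSet F := ⟨_, x, y, boolSign_eq b, rfl⟩

lemma dElt_mem (b : Bool) (s : F) : dElt b s ∈ DSet F := ⟨_, s, boolSign_eq b, rfl⟩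

lemma exists_hElt {g : SL3 F} (hg : g ∈ HSet F) : ∃ b x y, g = hElt b x y := by
  obtain ⟨a, x, y, ha, h⟩ := hg
  obtain ⟨b, rfl⟩ := exists_boolSign ha
  exact ⟨b, x, y, Subtype.ext h⟩

lemma exists_dElt {g : SL3 F} (hg : g ∈ DSet F) : ∃ b s, g = dElt b s := by
  obtain ⟨a, s, ha, h⟩ := hg
  obtain ⟨b, rfl⟩ := exists_boolSign ha
  exact ⟨b, s, Subtype.ext h⟩

lemma hMat_inj {a x y a' x' y' : F} :
    hMat F a x y = hMat F a' x' y' ↔ a = a' ∧ x = x' ∧ y = y' := by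
  refine ⟨fun h => ⟨?_, ?_, ?_⟩, by rintro ⟨rfl, rfl, rfl⟩; rfl⟩
  · simpa [hMat] using congrFun (congrFun h 0) 0
  · simpa [hMat] using congrFun (congrFun h 0) 2
  · simpa [hMat] using congrFun (congrFun h 1) 2

lemma hElt_mul (b b' : Bool) (x y x' y' : F) :
    hElt b x y * hElt b' x' y' =
      hElt (xor b b') (x + boolSign b * x') (y + boolSign b * y') := by
  refine Subtype.ext ?_
  rw [Matrix.SpecialLinearGroup.coe_mul]
  ext i j
  fin_cases i <;> fin_cases j <;>
    simp [hElt, hMat, Matrix.mul_apply, Fin.sum_univ_three, boolSign_xor, add_comm]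

lemma hElt_mul_inv (b b' : Bool) (x y x' y' : F) :
    hElt b x y * (hElt b' x' y')⁻¹ =
      hElt (xor b b') (x - boolSign (xor b b') * x') (y - boolSign (xor b b') * y') := by
  rw [mul_inv_eq_iff_eq_mul, hElt_mul]
  simp

lemma dElt_conj (h2 : (2 : F) ≠ 0) (a b : Bool) (s x y : F) :
    (dElt a s)⁻¹ * hElt b x y * dElt a s =
      hElt b (x - boolSign a * s * y + if b then s ^ 2 else 0)
        (boolSign a * y - if b then 2 * s else 0) := by
  rw [mul_assoc, inv_mul_eq_iff_eq_mul]
  refine Subtype.ext ?_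
  rw [Matrix.SpecialLinearGroup.coe_mul, Matrix.SpecialLinearGroup.coe_mul]
  ext i j
  cases b <;> fin_cases i <;> fin_cases j <;>
    simp [hElt, dElt, hMat, Matrix.mul_apply, Fin.sum_univ_three, boolSign_false, boolSign_true]
  · ring
  · ring
  · field_simp
    ring
  · ring

lemma hElt_mem_Porb (h2 : (2 : F) ≠ 0) (b : Bool) (x y t : F) :
    hElt b x y ∈ Porb F t ↔ b = true ∧ x - y ^ 2 / 4 = t := by
  have h4 := four_ne_zero_of_two_ne_zero h2
  have hb : (boolSign b : F) = -1 ↔ b = true := by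
    rw [← (boolSign_injective h2).eq_iff (a := b)]
    simp [boolSign]
  change (∃ z, hMat F (boolSign b) x y = hMat F (-1) (t + z ^ 2) (2 * z)) ↔ _
  simp only [hMat_inj, hb]
  constructor
  · rintro ⟨z, rfl, rfl, rfl⟩
    refine ⟨rfl, ?_⟩
    field_simp
    ring
  · rintro ⟨rfl, rfl⟩
    refine ⟨y / 2, rfl, ?_, ?_⟩
    · field_simp
      ring
    · field_simp

lemma hElt_mem_Corb (h2 : (2 : F) ≠ 0) (b : Bool) (x y t : F) :
    hElt b x y ∈ Corb F t ↔ b = false ∧ y = t := by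
  have hb : (boolSign b : F) = 1 ↔ b = false := by
    rw [← (boolSign_injective h2).eq_iff (a := b)]
    simp [boolSign]
  change (∃ z, hMat F (boolSign b) x y = hMat F 1 z t) ↔ _
  simp [hMat_inj, hb]

/-- Parabolic coordinates on `H`. -/
noncomputable def parabolicEquiv (h2 : (2 : F) ≠ 0) : Vert F ≃ ↥(HSet F) :=
  Equiv.ofBijective (fun u => ⟨hElt u.1 (u.2.1 + u.2.2 ^ 2 / 4) u.2.2, hElt_mem _ _ _⟩) <| by
    constructor
    · rintro ⟨b, X, y⟩ ⟨b', X', y'⟩ h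
      have h' := congrArg (fun g : ↥(HSet F) => ((g : SL3 F) : Matrix (Fin 3) (Fin 3) F)) h
      obtain ⟨h3, h4, h5⟩ := hMat_inj.1 h'
      obtain rfl := boolSign_injective h2 h3
      dsimp only at h4 h5
      subst h5
      simpa using h4
    · rintro ⟨g, hg⟩
      obtain ⟨b, x, y, rfl⟩ := exists_hElt hg
      exact ⟨(b, x - y ^ 2 / 4, y), by simp⟩

lemma coe_parabolicEquiv (h2 : (2 : F) ≠ 0) (u : Vert F) :
    (parabolicEquiv h2 u : SL3 F) = hElt u.1 (u.2.1 + u.2.2 ^ 2 / 4) u.2.2 := rfl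

/-- In parabolic coordinates the Cayley graph becomes the model. -/
lemma mul_inv_mem_iff_modelAdj (h2 : (2 : F) ≠ 0) {x : F} {T : Set (SL3 F)}
    (hT : T = Porb F 0 ∪ Porb F 1 ∪ Porb F x ∪ Corb F 1 ∪ Corb F (-1)) (u v : Vert F) :
    (parabolicEquiv h2 u : SL3 F) * (parabolicEquiv h2 v : SL3 F)⁻¹ ∈ T ↔
      modelAdj {0, 1, x} u v := by
  obtain ⟨b, X, y⟩ := u
  obtain ⟨b', X', y'⟩ := v
  simp only [coe_parabolicEquiv, hElt_mul_inv, hT, Set.mem_union, hElt_mem_Porb h2,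
    hElt_mem_Corb h2]
  have h4 := four_ne_zero_of_two_ne_zero h2
  have hX : X + y ^ 2 / 4 + (X' + y' ^ 2 / 4) - (y + y') ^ 2 / 4 = X + X' - y * y' / 2 := by
    field_simp
    ring
  cases b <;> cases b' <;>
    simp [-neg_add_rev, modelAdj, boolSign, hX, or_assoc]

/-- The standard permutations of `H`. -/
noncomputable def stdPerm [Finite F] (h2 : (2 : F) ≠ 0) (p : Bool × Bool × F × F × F) :
    Equiv.Perm ↥(HSet F) :=
  (parabolicEquiv h2).permCongr (modelPerm p)

lemma stdPerm_parabolicEquiv [Finite F] (h2 : (2 : F) ≠ 0) (p : Bool × Bool × F × F × F)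
    (u : Vert F) : stdPerm h2 p (parabolicEquiv h2 u) = parabolicEquiv h2 (modelMap p u) := by
  simp [stdPerm, modelPerm_apply, Equiv.permCongr_apply]

/-- Right multiplication by `h(±1,x,y)` is a standard permutation. -/
lemma stdPerm_eq_mul [Finite F] (h2 : (2 : F) ≠ 0) (r : Bool) (x y : F) (g : ↥(HSet F)) :
    (stdPerm h2 (r, false, y, -y, x - y ^ 2 / 4) g : SL3 F) = g * hElt r x y := by
  obtain ⟨⟨b, X, z⟩, rfl⟩ := (parabolicEquiv h2).surjective g
  have h4 := four_ne_zero_of_two_ne_zero h2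
  rw [stdPerm_parabolicEquiv, coe_parabolicEquiv, coe_parabolicEquiv, hElt_mul]
  cases b <;> simp only [modelMap, boolSign] <;> congr 1 <;> simp <;> field_simp <;> ring

/-- Conjugation by an element of `D` is a standard permutation. -/
lemma stdPerm_eq_conj [Finite F] (h2 : (2 : F) ≠ 0) (a : Bool) (s : F) (g : ↥(HSet F)) :
    (stdPerm h2 (false, a, 0, -2 * s, 0) g : SL3 F) = (dElt a s)⁻¹ * g * dElt a s := by
  obtain ⟨⟨b, X, z⟩, rfl⟩ := (parabolicEquiv h2).surjective g
  have h4 := four_ne_zero_of_two_ne_zero h2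
  have ha := boolSign_mul_self (F := F) a
  rw [stdPerm_parabolicEquiv, coe_parabolicEquiv, coe_parabolicEquiv, dElt_conj h2]
  cases b
  · rw [modelMap_false]
    congr 1
    · simp only [Bool.false_eq_true, if_false]
      field_simp
      linear_combination z ^ 2 * ha
    · simp
  · rw [modelMap_true]
    congr 1
    · simp only [if_true]
      field_simp
      linear_combination (2 * z ^ 2) * ha
    · simp only [if_true]
      ring

lemma stdPerm_eq_mul_conj [Finite F] (h2 : (2 : F) ≠ 0) (r a : Bool) (t₀ t₁ c : F) :
    stdPerm h2 (r, a, t₀, t₁, c) = stdPerm h2 (r, false, t₀, -t₀, c) *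
      stdPerm h2 (false, a, 0, t₀ + t₁, 0) := by
  refine Equiv.ext fun g => ?_
  obtain ⟨⟨b, X, z⟩, rfl⟩ := (parabolicEquiv h2).surjective g
  rw [Equiv.Perm.mul_apply]
  simp only [stdPerm_parabolicEquiv]
  congr 1
  cases b
  · simp only [modelMap_false, boolSign_false, Prod.mk.injEq, true_and]
    exact ⟨by ring, by ring⟩
  · simp only [modelMap_true, Bool.not_false, boolSign_false, Prod.mk.injEq, true_and]
    exact ⟨by ring, by ring⟩

lemma stdPerm_mem_GBar [Finite F] (h2 : (2 : F) ≠ 0) (p : Bool × Bool × F × F × F) :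
    stdPerm h2 p ∈ GBar F := by
  obtain ⟨r, a, t₀, t₁, c⟩ := p
  rw [stdPerm_eq_mul_conj]
  refine mul_mem (Subgroup.subset_closure (Or.inl ?_)) (Subgroup.subset_closure (Or.inr ?_))
  · refine ⟨hElt r (c + t₀ ^ 2 / 4) t₀, hElt_mem _ _ _, fun g => ?_⟩
    rw [← stdPerm_eq_mul h2, add_sub_cancel_right]
  · refine ⟨dElt a (-(t₀ + t₁) / 2), dElt_mem _ _, fun g => ?_⟩
    rw [← stdPerm_eq_conj h2]
    congr 6
    field_simp

/-- The automorphisms of `Cay(H,T)` form a subgroup. -/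
def cayAutSubgroup (T : Set (SL3 F)) : Subgroup (Equiv.Perm ↥(HSet F)) where
  carrier := CayAut F T
  one_mem' := fun _ _ => Iff.rfl
  mul_mem' := fun {_ τ} hσ hτ u v => (hτ u v).trans (hσ (τ u) (τ v))
  inv_mem' := fun {σ} hσ u v => by
    simpa using (hσ (σ⁻¹ u) (σ⁻¹ v)).symm

lemma mem_CayAut_iff (h2 : (2 : F) ≠ 0) {x : F} {T : Set (SL3 F)}
    (hT : T = Porb F 0 ∪ Porb F 1 ∪ Porb F x ∪ Corb F 1 ∪ Corb F (-1))
    (τ : Equiv.Perm (Vert F)) : (parabolicEquiv h2).permCongr τ ∈ CayAut F T ↔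
      ∀ u v, modelAdj {0, 1, x} u v ↔ modelAdj {0, 1, x} (τ u) (τ v) := by
  simp only [CayAut, Set.mem_ofPred_eq, (parabolicEquiv h2).surjective.forall,
    Equiv.permCongr_apply, Equiv.symm_apply_apply, mul_inv_mem_iff_modelAdj h2 hT]

lemma stdPerm_mem_CayAut [Finite F] (h2 : (2 : F) ≠ 0) {x : F} {T : Set (SL3 F)}
    (hT : T = Porb F 0 ∪ Porb F 1 ∪ Porb F x ∪ Corb F 1 ∪ Corb F (-1))
    (p : Bool × Bool × F × F × F) : stdPerm h2 p ∈ CayAut F T :=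
  (mem_CayAut_iff h2 hT _).2 (modelAdj_modelMap p h2)

lemma GBar_subset_CayAut [Finite F] (h2 : (2 : F) ≠ 0) {x : F} {T : Set (SL3 F)}
    (hT : T = Porb F 0 ∪ Porb F 1 ∪ Porb F x ∪ Corb F 1 ∪ Corb F (-1)) :
    (GBar F : Set (Equiv.Perm ↥(HSet F))) ⊆ CayAut F T := by
  suffices GBar F ≤ cayAutSubgroup T from this
  refine (Subgroup.closure_le _).2 ?_
  rintro σ (⟨h, -, hσ⟩ | ⟨d, hd, hσ⟩)
  · intro u v
    rw [hσ, hσ, _root_.mul_inv_rev, mul_assoc, mul_inv_cancel_left]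
  · obtain ⟨a, s, rfl⟩ := exists_dElt hd
    have : σ = stdPerm h2 (false, a, 0, -2 * s, 0) :=
      Equiv.ext fun g => Subtype.ext ((hσ g).trans (stdPerm_eq_conj h2 a s g).symm)
    rw [this]
    exact stdPerm_mem_CayAut h2 hT _

end Coordinates

theorem stmt16 (F : Type*) [Field F] [Fintype F]
    (hq : (Fintype.card F).Prime) (hq7 : 7 < Fintype.card F)
    (x : F) (hx : x ∉ ({0, 1, -1, 2, -2, 1 / 2} : Set F)) (hx6 : x ^ 6 ≠ 1)
    (T : Set (SL3 F))
    (hT : T = Porb F 0 ∪ Porb F 1 ∪ Porb F x ∪ Corb F 1 ∪ Corb F (-1)) :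
    CayAut F T = (GBar F : Set (Equiv.Perm ↥(HSet F))) ∧
    Nat.card (CayAut F T) = 4 * Fintype.card F ^ 3 := by
  have := Fact.mk hq
  have : CharP F (Fintype.card F) := charP_of_card_eq_prime rfl
  have hcast : ∀ n : ℕ, 0 < n → n < 8 → (n : F) ≠ 0 := fun n h0 h8 h =>
    absurd (Nat.le_of_dvd h0 ((CharP.cast_eq_zero_iff F (Fintype.card F) n).1 h)) (by omega)
  have h2 : (2 : F) ≠ 0 := mod_cast hcast 2 (by norm_num) (by norm_num)
  have h3 : (3 : F) ≠ 0 := mod_cast hcast 3 (by norm_num) (by norm_num)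
  simp only [Set.mem_insert_iff, Set.mem_singleton_iff, not_or] at hx
  obtain ⟨hx0, hx1, hxm, hx2, -, hxh⟩ := hx
  have hxh' : 2 * x ≠ 1 := fun h => hxh (by rw [eq_div_iff h2, mul_comm, h])
  have hS : ({0, 1, x} : Set F).ncard = 3 :=
    Set.ncard_eq_three.2 ⟨0, 1, x, zero_ne_one, Ne.symm hx0, Ne.symm hx1, rfl⟩
  have hshift : ∀ c : F, (∀ k, k ∈ ({0, 1, x} : Set F) ↔ k + c ∈ ({0, 1, x} : Set F)) → c = 0 := by
    intro c h
    simp only [Set.mem_insert_iff, Set.mem_singleton_iff] at h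
    have e0 := (h 0).1 (by simp)
    rw [zero_add] at e0
    rcases e0 with rfl | rfl | rfl
    · rfl
    · rcases (h 1).1 (by simp) with e | e | e
      · exact absurd (by linear_combination e) h2
      · exact absurd (by linear_combination e) (one_ne_zero (α := F))
      · exact absurd (by linear_combination -e) hx2
    · rcases (h c).1 (by simp) with e | e | e
      · exact absurd (by linear_combination e) (mul_ne_zero h2 hx0)
      · exact absurd (by linear_combination e) hxh'
      · exact absurd (by linear_combination e) hx0
  have hrefl : ∀ c : F, ¬ ∀ k, k ∈ ({0, 1, x} : Set F) ↔ c - k ∈ ({0, 1, x} : Set F) := by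
    intro c h
    simp only [Set.mem_insert_iff, Set.mem_singleton_iff] at h
    have e0 := (h 0).1 (by simp)
    rw [sub_zero] at e0
    rcases e0 with rfl | rfl | rfl
    · rcases (h 1).1 (by simp) with e | e | e
      · exact one_ne_zero (α := F) (by linear_combination -e)
      · exact h2 (by linear_combination -e)
      · exact hxm (by linear_combination -e)
    · rcases (h x).1 (by simp) with e | e | e
      · exact hx1 (by linear_combination -e)
      · exact hx0 (by linear_combination -e)
      · exact hxh' (by linear_combination -e)
    · rcases (h 1).1 (by simp) with e | e | e
      · exact hx1 (by linear_combination e)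
      · exact hx2 (by linear_combination e)
      · exact one_ne_zero (α := F) (by linear_combination -e)
  have hrange : CayAut F T = Set.range (stdPerm h2) := by
    refine Set.Subset.antisymm (fun σ hσ => ?_)
      (Set.range_subset_iff.2 (stdPerm_mem_CayAut h2 hT))
    obtain ⟨τ, rfl⟩ := (parabolicEquiv h2).permCongr.surjective σ
    obtain ⟨p, rfl⟩ := exists_eq_modelPerm hq h2 h3 hS (by simp) hshift hrefl
      ((mem_CayAut_iff h2 hT τ).1 hσ)
    exact ⟨p, rfl⟩
  refine ⟨Set.Subset.antisymm ?_ (GBar_subset_CayAut h2 hT), ?_⟩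
  · rw [hrange]
    exact Set.range_subset_iff.2 (stdPerm_mem_GBar h2)
  · have hinj : Function.Injective (stdPerm (F := F) h2) :=
      (parabolicEquiv h2).permCongr.injective.comp (modelPerm_injective h2)
    rw [hrange, Nat.card_range_of_injective hinj]
    simp only [Nat.card_prod, Nat.card_eq_fintype_card (α := F), Nat.card_eq_fintype_card (α := Bool),
      Fintype.card_bool]
    ring
end

section
/- For every odd prime p, the generalised dihedral group Dih(Z_p × Z_p) over the elementary abelian group of order p² is not a DCI-group. Moreover, for every prime p ≥ 5, Dih(Z_p × Z_p) is not a CI-group. -/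
def IsDCIGraph {R : Type*} [Group R] (S : Set R) : Prop :=
  ∀ T : Set R,
    (∃ e : R ≃ R, ∀ x y : R, x * y⁻¹ ∈ S ↔ e x * (e y)⁻¹ ∈ T) →
    ∃ φ : R ≃* R, φ '' S = T

def IsDCIGroup (R : Type*) [Group R] : Prop := ∀ S : Set R, IsDCIGraph S

def IsCIGroup (R : Type*) [Group R] : Prop := ∀ S : Set R, S⁻¹ = S → IsDCIGraph S

/-- `R` is a generalised dihedral group over the abelian group `A`. -/
def IsGeneralizedDihedral (A : Type*) (R : Type*) [CommGroup A] [Group R] : Prop :=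
  ∃ (ι : A →* R) (x : R), Function.Injective ι ∧ x ^ 2 = 1 ∧ x ∉ ι.range ∧
    (∀ a : A, x⁻¹ * ι a * x = ι a⁻¹) ∧ (∀ r : R, r ∈ ι.range ∨ ∃ a : A, r = ι a * x)

/-- Coordinates `A ⊕ A ≃ R` on a generalised dihedral group over `A`: the left summand is the
abelian subgroup and the right summand its nontrivial coset, consisting of involutions. -/
structure DihedralCoordinates (A R : Type*) [AddCommGroup A] [Group R] where
  g : A ⊕ A ≃ R
  inl_mul_inl : ∀ v w, g (.inl v) * g (.inl w) = g (.inl (v + w))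
  inl_mul_inr : ∀ v w, g (.inl v) * g (.inr w) = g (.inr (v + w))
  inr_mul_inl : ∀ v w, g (.inr v) * g (.inl w) = g (.inr (v - w))
  inr_mul_inr : ∀ v w, g (.inr v) * g (.inr w) = g (.inl (v - w))

theorem IsGeneralizedDihedral.nonempty_coordinates {A R : Type*} [AddCommGroup A] [Group R]
    (h : IsGeneralizedDihedral (Multiplicative A) R) : Nonempty (DihedralCoordinates A R) := by
  obtain ⟨ι, x, hinj, hx2, hx, hconj, hsurj⟩ := h
  have hxx : x * x = 1 := by rw [← sq, hx2]
  have hcomm : ∀ a, x * ι a = ι a⁻¹ * x := fun a => by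
    have h1 := hconj a⁻¹
    rw [inv_inv] at h1
    rw [← h1, mul_assoc, mul_inv_cancel_left]
  let f : A ⊕ A → R :=
    Sum.elim (fun v => ι (Multiplicative.ofAdd v)) (fun v => ι (Multiplicative.ofAdd v) * x)
  have hf : Function.Bijective f := by
    constructor
    · rintro (v | v) (w | w) hvw
      · exact congrArg Sum.inl (hinj hvw)
      · refine absurd ?_ hx
        refine ⟨(Multiplicative.ofAdd w)⁻¹ * Multiplicative.ofAdd v, ?_⟩
        have : ι (Multiplicative.ofAdd v) = ι (Multiplicative.ofAdd w) * x := hvw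
        rw [map_mul, this, map_inv, inv_mul_cancel_left]
      · refine absurd ?_ hx
        refine ⟨(Multiplicative.ofAdd v)⁻¹ * Multiplicative.ofAdd w, ?_⟩
        have : ι (Multiplicative.ofAdd v) * x = ι (Multiplicative.ofAdd w) := hvw
        rw [map_mul, ← this, map_inv, inv_mul_cancel_left]
      · exact congrArg Sum.inr (hinj (mul_right_cancel hvw))
    · intro r
      rcases hsurj r with ⟨a, rfl⟩ | ⟨a, rfl⟩
      · exact ⟨.inl a.toAdd, rfl⟩
      · exact ⟨.inr a.toAdd, rfl⟩
  refine ⟨⟨Equiv.ofBijective f hf, fun v w => ?_, fun v w => ?_, fun v w => ?_, fun v w => ?_⟩⟩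
  · simp [f]
  · simp [f, mul_assoc]
  · simp [f, mul_assoc, hcomm, sub_eq_add_neg]
  · simp only [Equiv.ofBijective_apply, f, Sum.elim_inr, Sum.elim_inl, sub_eq_add_neg, ofAdd_add,
      ofAdd_neg, map_mul]
    rw [mul_assoc, ← mul_assoc x, hcomm, mul_assoc _ x x, hxx, mul_one]

namespace DihedralCoordinates

section General

variable {A R : Type*} [AddCommGroup A] [Group R] (c : DihedralCoordinates A R)

theorem inl_zero : c.g (.inl 0) = 1 := by
  have h := c.inl_mul_inl 0 0
  rw [add_zero] at h
  exact mul_eq_left.mp h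

theorem inv_inl (v : A) : (c.g (.inl v))⁻¹ = c.g (.inl (-v)) :=
  inv_eq_of_mul_eq_one_right (by rw [c.inl_mul_inl, add_neg_cancel, c.inl_zero])

theorem inv_inr (v : A) : (c.g (.inr v))⁻¹ = c.g (.inr v) :=
  inv_eq_of_mul_eq_one_right (by rw [c.inr_mul_inr, sub_self, c.inl_zero])

/-- If `A` has no 2-torsion, then every automorphism of `R` is affine in coordinates. -/
theorem exists_affine (hA : ∀ v : A, v + v = 0 → v = 0) (φ : R ≃* R) :
    ∃ (L : A →+ A) (b : A), (∀ v, φ (c.g (.inl v)) = c.g (.inl (L v))) ∧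
      ∀ v, φ (c.g (.inr v)) = c.g (.inr (L v + b)) := by
  have h1 : ∀ v, ∃ w, φ (c.g (.inl v)) = c.g (.inl w) := fun v => by
    obtain ⟨w | w, hw⟩ := c.g.surjective (φ (c.g (.inl v)))
    · exact ⟨w, hw.symm⟩
    · have h : φ (c.g (.inl v) * c.g (.inl v)) = 1 := by
        rw [map_mul, ← hw, c.inr_mul_inr, sub_self, c.inl_zero]
      rw [EmbeddingLike.map_eq_one_iff, c.inl_mul_inl, ← c.inl_zero] at h
      have hv : v = 0 := hA v (Sum.inl_injective (c.g.injective h))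
      refine ⟨0, ?_⟩
      rw [hv, c.inl_zero, map_one]
  have h2 : ∃ b, φ (c.g (.inr 0)) = c.g (.inr b) := by
    obtain ⟨w | w, hw⟩ := c.g.surjective (φ (c.g (.inr 0)))
    · have h : c.g (.inl w) * c.g (.inl w) = 1 := by
        rw [hw, ← map_mul, c.inr_mul_inr, sub_self, c.inl_zero, map_one]
      rw [c.inl_mul_inl, ← c.inl_zero] at h
      rw [hA w (Sum.inl_injective (c.g.injective h)), c.inl_zero, eq_comm,
        EmbeddingLike.map_eq_one_iff, ← c.inl_zero] at hw
      cases c.g.injective hw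
    · exact ⟨w, hw.symm⟩
  choose L hL using h1
  obtain ⟨b, hb⟩ := h2
  refine ⟨AddMonoidHom.mk' L fun v w => ?_, b, hL, fun v => ?_⟩
  · apply Sum.inl_injective
    apply c.g.injective
    rw [← c.inl_mul_inl, ← hL, ← hL, ← hL, ← map_mul, c.inl_mul_inl]
  · have h := c.inl_mul_inr v 0
    rw [add_zero] at h
    rw [← h, map_mul, hL, hb, c.inl_mul_inr]
    rfl

end General

section Parabola

variable {F R : Type*} [Field F] [Group R] (c : DihedralCoordinates (F × F) R)

/-- The connection set made of the translations `(0, y)` with `y ∈ Y₀` and of the involutions on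
the parabolas `y = k x² + z` with `z ∈ Y`. -/
def parabolaSet (Y₀ Y : Set F) (k : F) : Set R :=
  c.g '' {s | Sum.elim (fun v => v.1 = 0 ∧ v.2 ∈ Y₀) (fun v => v.2 - k * v.1 ^ 2 ∈ Y) s}

theorem inl_mem_parabolaSet {Y₀ Y : Set F} {k : F} {v : F × F} :
    c.g (.inl v) ∈ c.parabolaSet Y₀ Y k ↔ v.1 = 0 ∧ v.2 ∈ Y₀ := by
  simp [parabolaSet]

theorem inr_mem_parabolaSet {Y₀ Y : Set F} {k : F} {v : F × F} :
    c.g (.inr v) ∈ c.parabolaSet Y₀ Y k ↔ v.2 - k * v.1 ^ 2 ∈ Y := by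
  simp [parabolaSet]

theorem inv_parabolaSet {Y₀ Y : Set F} {k : F} (h : ∀ y ∈ Y₀, -y ∈ Y₀) :
    (c.parabolaSet Y₀ Y k)⁻¹ = c.parabolaSet Y₀ Y k := by
  have h' : ∀ y, -y ∈ Y₀ ↔ y ∈ Y₀ := fun y => ⟨fun hy => neg_neg y ▸ h _ hy, h y⟩
  ext r
  obtain ⟨v | v, rfl⟩ := c.g.surjective r
  · rw [Set.mem_inv, c.inv_inl, c.inl_mem_parabolaSet, c.inl_mem_parabolaSet]
    simp [h']
  · rw [Set.mem_inv, c.inv_inr]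

/-- The shear `(x, y) ↦ (l x, y + m x²)` of the plane. -/
def shear (l m : F) (hl : l ≠ 0) : F × F ≃ F × F where
  toFun v := (l * v.1, v.2 + m * v.1 ^ 2)
  invFun v := (l⁻¹ * v.1, v.2 - m * (l⁻¹ * v.1) ^ 2)
  left_inv v := by
    ext
    · simp [hl]
    · simp [hl]
  right_inv v := by
    ext
    · simp [hl]
    · simp

theorem exists_parabolaSet_iso (Y₀ Y : Set F) {k : F} (hk : k ≠ 0) :
    ∃ e : R ≃ R, ∀ x y : R,
      x * y⁻¹ ∈ c.parabolaSet Y₀ Y 1 ↔ e x * (e y)⁻¹ ∈ c.parabolaSet Y₀ Y k := by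
  have hk' : k⁻¹ ≠ 0 := inv_ne_zero hk
  have key : ∀ v w : F × F, v.2 + w.2 - 1 * (v.1 + w.1) ^ 2 =
      v.2 + (k - 1) * v.1 ^ 2 + (w.2 + (k⁻¹ - 1) * w.1 ^ 2) - k * (v.1 + k⁻¹ * w.1) ^ 2 := by
    intro v w
    field_simp
    ring
  refine ⟨c.g.symm.trans ((Equiv.sumCongr (shear 1 (k - 1) one_ne_zero)
    (shear k⁻¹ (k⁻¹ - 1) hk')).trans c.g), fun x y => ?_⟩
  obtain ⟨v | v, rfl⟩ := c.g.surjective x <;> obtain ⟨w | w, rfl⟩ := c.g.surjective y <;>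
  simp only [Equiv.trans_apply, Equiv.symm_apply_apply, Equiv.sumCongr_apply, Sum.map_inl,
    Sum.map_inr, c.inv_inl, c.inv_inr, c.inl_mul_inl, c.inl_mul_inr, c.inr_mul_inl, c.inr_mul_inr,
    sub_neg_eq_add, ← sub_eq_add_neg, c.inl_mem_parabolaSet, c.inr_mem_parabolaSet]
  · simp only [shear, Equiv.coe_fn_mk, Prod.fst_sub, Prod.snd_sub, one_mul]
    refine and_congr_right fun h => ?_
    rw [sub_eq_zero.mp h, add_sub_add_right_eq_sub]
  · rw [Prod.snd_add, Prod.fst_add, key]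
    simp [shear]
  · rw [add_comm v w, Prod.snd_add, Prod.fst_add, key]
    simp [shear, add_comm]
  · simp only [shear, Equiv.coe_fn_mk, Prod.fst_sub, Prod.snd_sub, ← mul_sub, mul_eq_zero, hk',
      false_or]
    refine and_congr_right fun h => ?_
    rw [sub_eq_zero.mp h, add_sub_add_right_eq_sub]

end Parabola

section ZMod

variable {p : ℕ} [Fact p.Prime] {R : Type*} [Group R]
  (c : DihedralCoordinates (ZMod p × ZMod p) R)

theorem exists_quadratic_of_image_eq (h2 : (2 : ZMod p) ≠ 0) {Y₀ Y : Set (ZMod p)} (h1 : 1 ∈ Y₀)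
    {k : ZMod p} {φ : R ≃* R} (hφ : φ '' c.parabolaSet Y₀ Y 1 = c.parabolaSet Y₀ Y k) :
    ∃ ε ∈ Y₀, ∃ a b d : ZMod p, ∀ u, ∀ z ∈ Y,
      (ε - k * a ^ 2) * u ^ 2 + b * u + d + ε * z ∈ Y := by
  have hF : ∀ t : ZMod p, t + t = 0 → t = 0 := fun t ht => by
    rw [← two_mul] at ht
    exact (mul_eq_zero.mp ht).resolve_left h2
  obtain ⟨L, b, hL, hR⟩ := c.exists_affine
    (fun v hv => Prod.ext (hF _ (congrArg Prod.fst hv)) (hF _ (congrArg Prod.snd hv))) φ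
  have hmem : ∀ r ∈ c.parabolaSet Y₀ Y 1, φ r ∈ c.parabolaSet Y₀ Y k := fun r hr =>
    hφ ▸ Set.mem_image_of_mem _ hr
  have h01 := hmem _ ((c.inl_mem_parabolaSet (v := (0, 1))).mpr ⟨rfl, h1⟩)
  rw [hL, c.inl_mem_parabolaSet] at h01
  have hlin : ∀ u v : ZMod p, L (u, v) = u • L (1, 0) + v • L (0, 1) := fun u v => by
    have h : ∀ (t : ZMod p) w, L (t • w) = t • L w := (L.toZModLinearMap p).map_smul
    rw [← h, ← h, ← map_add]
    simp
  refine ⟨(L (0, 1)).2, h01.2, (L (1, 0)).1, (L (1, 0)).2 - 2 * k * (L (1, 0)).1 * b.1,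
    b.2 - k * b.1 ^ 2, fun u z hz => ?_⟩
  have h := hmem _ ((c.inr_mem_parabolaSet (v := (u, u ^ 2 + z))).mpr (by simpa using hz))
  rw [hR, c.inr_mem_parabolaSet, hlin] at h
  simp only [Prod.fst_add, Prod.snd_add, Prod.smul_fst, Prod.smul_snd, h01.1, smul_eq_mul] at h
  convert h using 1
  ring

/-- If the set `ε Y + t` is contained in `Y` for at most one value of `t`, then an automorphism
forces `k a² = ε`. -/
theorem exists_eq_mul_sq_of_image_eq (h2 : (2 : ZMod p) ≠ 0) {Y₀ Y : Set (ZMod p)} (h1 : 1 ∈ Y₀)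
    (hY : ∀ ε ∈ Y₀, ∀ s t : ZMod p, (∀ z ∈ Y, s + ε * z ∈ Y) → (∀ z ∈ Y, t + ε * z ∈ Y) → s = t)
    {k : ZMod p} {φ : R ≃* R} (hφ : φ '' c.parabolaSet Y₀ Y 1 = c.parabolaSet Y₀ Y k) :
    ∃ ε ∈ Y₀, (∃ t, ∀ z ∈ Y, t + ε * z ∈ Y) ∧ ∃ a, ε = k * a ^ 2 := by
  obtain ⟨ε, hε, a, b, d, h⟩ := c.exists_quadratic_of_image_eq h2 h1 hφ
  refine ⟨ε, hε, ⟨_, h 0⟩, a, ?_⟩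
  have e1 := hY ε hε _ _ (h 1) (h 0)
  have e2 := hY ε hε _ _ (h (-1)) (h 0)
  have e3 : 2 * (ε - k * a ^ 2) = 0 := by linear_combination e1 + e2
  exact sub_eq_zero.mp ((mul_eq_zero.mp e3).resolve_left h2)

end ZMod

end DihedralCoordinates

theorem isSquare_of_one_eq_mul_sq {F : Type*} [Field F] {k a : F} (h : 1 = k * a ^ 2) :
    IsSquare k := by
  have ha : a ≠ 0 := by
    rintro rfl
    simp at h
  exact ⟨a⁻¹, by field_simp; exact h.symm⟩

/-- A translate of `{0, 1, 3}` lies in `{0, 1, 3}` only trivially. -/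
theorem translate_zero_one_three {F : Type*} [Field F] (h2 : (2 : F) ≠ 0)
    {t : F} (h : ∀ z ∈ ({0, 1, 3} : Set F), t + 1 * z ∈ ({0, 1, 3} : Set F)) : t = 0 := by
  have a := h 0 (by simp)
  have b := h 1 (by simp)
  simp only [Set.mem_insert_iff, Set.mem_singleton_iff] at a b
  grind

/-- A translate of `{0, -1, -3}` lies in `{0, 1, 3}` only in characteristic `5`. -/
theorem translate_neg_zero_one_three {F : Type*} [Field F] (h2 : (2 : F) ≠ 0) (h3 : (3 : F) ≠ 0)
    {t : F} (h : ∀ z ∈ ({0, 1, 3} : Set F), t + -1 * z ∈ ({0, 1, 3} : Set F)) :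
    t = 1 ∧ (5 : F) = 0 := by
  have h4 : (4 : F) ≠ 0 := by
    rw [show (4 : F) = 2 * 2 by norm_num]
    exact mul_ne_zero h2 h2
  have a := h 0 (by simp)
  have b := h 1 (by simp)
  have d := h 3 (by simp)
  simp only [Set.mem_insert_iff, Set.mem_singleton_iff] at a b d
  grind

/-- For every odd prime `p`, `Dih(Z_p × Z_p)` is not a DCI-group; for `p ≥ 5` it is not
even a CI-group. -/
theorem stmt17 (p : ℕ) (hp : p.Prime) (hodd : Odd p) (R : Type*) [Group R]
    (hR : IsGeneralizedDihedral (Multiplicative (ZMod p × ZMod p)) R) :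
    ¬ IsDCIGroup R ∧ (5 ≤ p → ¬ IsCIGroup R) := by
  have : Fact p.Prime := ⟨hp⟩
  obtain ⟨c⟩ := hR.nonempty_coordinates
  have hp2 : p ≠ 2 := by
    rintro rfl
    exact absurd hodd (by decide)
  have h2 : (2 : ZMod p) ≠ 0 := fun h => by
    have h' : ((2 : ℕ) : ZMod p) = 0 := by exact_mod_cast h
    rw [ZMod.natCast_eq_zero_iff] at h'
    exact hp2 ((Nat.prime_dvd_prime_iff_eq hp Nat.prime_two).mp h')
  obtain ⟨k, hk⟩ := FiniteField.exists_nonsquare (F := ZMod p) (by rwa [ZMod.ringChar_zmod_n])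
  have hk0 : k ≠ 0 := by
    rintro rfl
    exact hk IsSquare.zero
  constructor
  · intro hDCI
    obtain ⟨φ, hφ⟩ := hDCI (c.parabolaSet {1} {0} 1) _ (c.exists_parabolaSet_iso {1} {0} hk0)
    obtain ⟨ε, rfl, -, a, ha⟩ := c.exists_eq_mul_sq_of_image_eq h2 (Set.mem_singleton 1)
      (fun ε _ s t hs ht => by
        have hs' := hs 0 rfl
        have ht' := ht 0 rfl
        simp only [mul_zero, add_zero, Set.mem_singleton_iff] at hs' ht'
        rw [hs', ht']) hφ
    exact hk (isSquare_of_one_eq_mul_sq ha)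
  · intro hp5 hCI
    have h3 : (3 : ZMod p) ≠ 0 := fun h => by
      have h' : ((3 : ℕ) : ZMod p) = 0 := by exact_mod_cast h
      rw [ZMod.natCast_eq_zero_iff] at h'
      have := Nat.le_of_dvd (by norm_num) h'
      omega
    obtain ⟨φ, hφ⟩ := hCI (c.parabolaSet {1, -1} {0, 1, 3} 1)
      (c.inv_parabolaSet (by rintro y (rfl | rfl) <;> simp)) _
      (c.exists_parabolaSet_iso {1, -1} {0, 1, 3} hk0)
    obtain ⟨ε, hε, ⟨t, ht⟩, a, ha⟩ := c.exists_eq_mul_sq_of_image_eq h2 (by simp)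
      (by
        rintro ε (rfl | rfl) s t hs ht
        · rw [translate_zero_one_three h2 hs, translate_zero_one_three h2 ht]
        · rw [(translate_neg_zero_one_three h2 h3 hs).1,
            (translate_neg_zero_one_three h2 h3 ht).1]) hφ
    rcases hε with rfl | rfl
    · exact hk (isSquare_of_one_eq_mul_sq ha)
    · have h5 := (translate_neg_zero_one_three h2 h3 ht).2
      exact hk (isSquare_of_one_eq_mul_sq (a := 2 * a) (by linear_combination 4 * ha + h5))
end

section
/- For every integer k ≥ 3, the elementary abelian group Z_3^k is not a BCI-group: there exist subsets S, T ⊆ Z_3^k such that the Haar graphs of Z_3^k with connection sets S and T are isomorphic as graphs, but there is no group automorphism σ of Z_3^k and element g ∈ Z_3^k with T = σ(S) + g. -/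
/-- The adjacency relation of the Haar graph of the (additive) abelian group `A` with
connection set `S`: the vertex set is `A × ZMod 2` and `(a,0)` is joined to `(s+a,1)`
for `a ∈ A`, `s ∈ S`. -/
def HaarAdj {A : Type*} [AddCommGroup A] (S : Set A) (v w : A × ZMod 2) : Prop :=
  (v.2 = 0 ∧ w.2 = 1 ∧ w.1 - v.1 ∈ S) ∨ (v.2 = 1 ∧ w.2 = 0 ∧ v.1 - w.1 ∈ S)

/-- The vectors of `F_3^(n+3)` supported on the first three coordinates and lying on the
graph of the function `q` of two variables there. -/
def surface (n : ℕ) (q : ZMod 3 → ZMod 3 → ZMod 3) : Set (Fin (n + 3) → ZMod 3) :=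
  {v | v 2 = q (v 0) (v 1) ∧ ∀ j, j ≠ 0 → j ≠ 1 → j ≠ 2 → v j = 0}

/-- Replace the first three coordinates of a vector. -/
def setThree {n : ℕ} (v : Fin (n + 3) → ZMod 3) (x y z : ZMod 3) : Fin (n + 3) → ZMod 3 :=
  fun j => if j = 0 then x else if j = 1 then y else if j = 2 then z else v j

section setThree

variable {n : ℕ} (v : Fin (n + 3) → ZMod 3) (x y z : ZMod 3)

theorem fin_one_ne_zero : (1 : Fin (n + 3)) ≠ 0 := by
  simp

theorem fin_two_ne_zero : (2 : Fin (n + 3)) ≠ 0 := by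
  exact Fin.ne_of_val_ne (by rw [Fin.val_two]; simp)

theorem fin_two_ne_one : (2 : Fin (n + 3)) ≠ 1 := by
  exact Fin.ne_of_val_ne (by rw [Fin.val_two]; simp)

theorem setThree_zero : setThree v x y z 0 = x := by
  simp [setThree]

theorem setThree_one : setThree v x y z 1 = y := by
  simp [setThree]

theorem setThree_two : setThree v x y z 2 = z := by
  simp [setThree, fin_two_ne_zero, fin_two_ne_one]

theorem setThree_of_ne {j : Fin (n + 3)} (h0 : j ≠ 0) (h1 : j ≠ 1) (h2 : j ≠ 2) :
    setThree v x y z j = v j := by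
  simp [setThree, h0, h1, h2]

end setThree

/-- A graph isomorphism from the Haar graph of the elliptic paraboloid to that of the
hyperbolic paraboloid over `F_3`. -/
def paraboloidMap (n : ℕ) (p : (Fin (n + 3) → ZMod 3) × ZMod 2) :
    (Fin (n + 3) → ZMod 3) × ZMod 2 :=
  (if p.2 = 0 then
      setThree p.1 (-p.1 1) (-p.1 0) (p.1 2 + p.1 0 ^ 2 + p.1 1 ^ 2 - p.1 0 * p.1 1)
    else
      setThree p.1 (p.1 0) (p.1 1) (p.1 2 - p.1 0 ^ 2 - p.1 1 ^ 2 + p.1 0 * p.1 1), p.2)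

theorem setThree_inj {n : ℕ} {v w : Fin (n + 3) → ZMod 3} {x y z x' y' z' : ZMod 3}
    (h : setThree v x y z = setThree w x' y' z') :
    x = x' ∧ y = y' ∧ z = z' ∧ ∀ j, j ≠ 0 → j ≠ 1 → j ≠ 2 → v j = w j := by
  refine ⟨?_, ?_, ?_, fun j h0 h1 h2 => ?_⟩
  · simpa only [setThree_zero] using congrFun h 0
  · simpa only [setThree_one] using congrFun h 1
  · simpa only [setThree_two] using congrFun h 2
  · simpa only [setThree_of_ne _ _ _ _ h0 h1 h2] using congrFun h j

theorem ext_three {n : ℕ} {v w : Fin (n + 3) → ZMod 3} (h0 : v 0 = w 0) (h1 : v 1 = w 1)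
    (h2 : v 2 = w 2) (h : ∀ j, j ≠ 0 → j ≠ 1 → j ≠ 2 → v j = w j) : v = w := by
  funext j
  by_cases j0 : j = 0
  · rw [j0, h0]
  by_cases j1 : j = 1
  · rw [j1, h1]
  by_cases j2 : j = 2
  · rw [j2, h2]
  exact h j j0 j1 j2

theorem paraboloidMap_injective (n : ℕ) : Function.Injective (paraboloidMap n) := by
  rintro ⟨v, i⟩ ⟨w, j⟩ h
  obtain ⟨h, rfl⟩ := Prod.ext_iff.mp h
  change ite (i = 0) _ _ = ite (i = 0) _ _ at h
  refine Prod.ext ?_ rfl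
  by_cases hi : i = 0
  · rw [if_pos hi, if_pos hi] at h
    obtain ⟨h1, h0, h2, h⟩ := setThree_inj h
    have h0 : v 0 = w 0 := neg_injective h0
    have h1 : v 1 = w 1 := neg_injective h1
    refine ext_three h0 h1 ?_ h
    simp only [h0, h1] at h2
    linear_combination h2
  · rw [if_neg hi, if_neg hi] at h
    obtain ⟨h0, h1, h2, h⟩ := setThree_inj h
    refine ext_three h0 h1 ?_ h
    simp only at h0 h1
    simp only [h0, h1] at h2
    linear_combination h2

theorem paraboloidMap_sub_mem_iff {n : ℕ} (a b : Fin (n + 3) → ZMod 3) :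
    (paraboloidMap n (b, 1)).1 - (paraboloidMap n (a, 0)).1 ∈ surface n (fun x y => x * y) ↔
      b - a ∈ surface n (fun x y => x ^ 2 + y ^ 2) := by
  simp only [paraboloidMap, surface, Set.mem_ofPred_eq, Pi.sub_apply, one_ne_zero, if_true,
    if_false, setThree_zero, setThree_one, setThree_two]
  refine and_congr ?_ (forall_congr' fun j => ?_)
  · have h3 : (3 : ZMod 3) = 0 := rfl
    constructor <;> intro h
    · linear_combination h + (b 0 * a 0 + a 1 * b 1) * h3
    · linear_combination h - (b 0 * a 0 + a 1 * b 1) * h3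
  · refine forall_congr' fun h0 => forall_congr' fun h1 => forall_congr' fun h2 => ?_
    rw [setThree_of_ne _ _ _ _ h0 h1 h2, setThree_of_ne _ _ _ _ h0 h1 h2]

theorem haarAdj_paraboloidMap_iff {n : ℕ} (v w : (Fin (n + 3) → ZMod 3) × ZMod 2) :
    HaarAdj (surface n fun x y => x ^ 2 + y ^ 2) v w ↔
      HaarAdj (surface n fun x y => x * y) (paraboloidMap n v) (paraboloidMap n w) := by
  obtain ⟨a, i⟩ := v
  obtain ⟨b, j⟩ := w
  refine or_congr ?_ ?_
  · refine and_congr_right fun hi => and_congr_right fun hj => ?_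
    obtain rfl : i = 0 := hi
    obtain rfl : j = 1 := hj
    exact (paraboloidMap_sub_mem_iff a b).symm
  · refine and_congr_right fun hi => and_congr_right fun hj => ?_
    obtain rfl : i = 1 := hi
    obtain rfl : j = 0 := hj
    exact (paraboloidMap_sub_mem_iff b a).symm

/-- The elliptic paraboloid over `F_3` is a cap: it contains no affine line. -/
theorem eq_of_mem_elliptic_of_add_eq_zero {n : ℕ} {a b c : Fin (n + 3) → ZMod 3}
    (ha : a ∈ surface n fun x y => x ^ 2 + y ^ 2) (hb : b ∈ surface n fun x y => x ^ 2 + y ^ 2)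
    (hc : c ∈ surface n fun x y => x ^ 2 + y ^ 2) (h : a + b + c = 0) : a = b := by
  have key : ∀ x y x' y' : ZMod 3,
      x ^ 2 + y ^ 2 + (x' ^ 2 + y' ^ 2) + ((-(x + x')) ^ 2 + (-(y + y')) ^ 2) = 0 →
        x = x' ∧ y = y' := by decide
  have hsum (j) : a j + b j + c j = 0 := congrFun h j
  have hc' (j) : c j = -(a j + b j) := by linear_combination hsum j
  have h2 := hsum 2
  rw [ha.1, hb.1, hc.1, hc' 0, hc' 1] at h2
  obtain ⟨h0, h1⟩ := key _ _ _ _ h2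
  refine ext_three h0 h1 ?_ fun j j0 j1 j2 => ?_
  · rw [ha.1, hb.1, h0, h1]
  · rw [ha.2 j j0 j1 j2, hb.2 j j0 j1 j2]

theorem axis_mem_hyperbolic {n : ℕ} (t : ZMod 3) :
    setThree (0 : Fin (n + 3) → ZMod 3) t 0 0 ∈ surface n fun x y => x * y := by
  refine ⟨?_, fun j h0 h1 h2 => ?_⟩
  · simp only [setThree_one, setThree_two, mul_zero]
  · rw [setThree_of_ne _ _ _ _ h0 h1 h2, Pi.zero_apply]

theorem axis_sum {n : ℕ} :
    setThree (0 : Fin (n + 3) → ZMod 3) 0 0 0 + setThree 0 1 0 0 + setThree 0 2 0 0 = 0 := by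
  refine ext_three ?_ ?_ ?_ fun j h0 h1 h2 => ?_
  · simp only [Pi.add_apply, setThree_zero]; rfl
  · simp only [Pi.add_apply, setThree_one]; rfl
  · simp only [Pi.add_apply, setThree_two]; rfl
  · simp only [Pi.add_apply, setThree_of_ne _ _ _ _ h0 h1 h2]; rfl

/-- For every `k ≥ 3`, the elementary abelian group `Z_3^k` is not a BCI-group: there are
connection sets `S`, `T` with isomorphic Haar graphs such that no group automorphism `σ`
and translation `g` satisfy `T = σ(S) + g`. -/
theorem stmt19 (k : ℕ) (hk : 3 ≤ k) :
    ∃ S T : Set (Fin k → ZMod 3),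
      (∃ e : (Fin k → ZMod 3) × ZMod 2 ≃ (Fin k → ZMod 3) × ZMod 2,
        ∀ v w, HaarAdj S v w ↔ HaarAdj T (e v) (e w)) ∧
      ¬ ∃ (σ : (Fin k → ZMod 3) ≃+ (Fin k → ZMod 3)) (g : Fin k → ZMod 3),
        T = (fun a => σ a + g) '' S := by
  obtain ⟨n, rfl⟩ := Nat.exists_eq_add_of_le' hk
  refine ⟨surface n fun x y => x ^ 2 + y ^ 2, surface n fun x y => x * y,
    ⟨Equiv.ofBijective _ (Finite.injective_iff_bijective.mp (paraboloidMap_injective n)),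
      haarAdj_paraboloidMap_iff⟩, ?_⟩
  rintro ⟨σ, g, hT⟩
  have hmem (t : ZMod 3) := axis_mem_hyperbolic (n := n) t
  rw [hT] at hmem
  obtain ⟨a, ha, ha'⟩ := hmem 0
  obtain ⟨b, hb, hb'⟩ := hmem 1
  obtain ⟨c, hc, hc'⟩ := hmem 2
  have hg : g + g + g = 0 := by
    funext j
    have : ∀ x : ZMod 3, x + x + x = 0 := by decide
    exact this (g j)
  have hσ : σ (a + b + c) = 0 := by
    have h := axis_sum (n := n)
    rw [← ha', ← hb', ← hc'] at h
    calc σ (a + b + c) = σ a + g + (σ b + g) + (σ c + g) - (g + g + g) := by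
          rw [map_add, map_add]; abel
      _ = 0 := by rw [hg, sub_zero]; exact h
  obtain rfl := eq_of_mem_elliptic_of_add_eq_zero ha hb hc ((map_eq_zero_iff σ σ.injective).mp hσ)
  exact zero_ne_one (setThree_inj (ha'.symm.trans hb')).1
end
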